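/- arXiv:2512.20680 — 2 statements merged into one kernel-verified Lean document; each statement's English description precedes it below -/
import Mathlib

section
/- Pick's Theorem: for every lattice polygon P ⊂ ℝ² (a two-dimensional lattice polytope), the Euclidean area of P equals |P° ∩ ℤ²| + |∂P ∩ ℤ²|/2 − 1, where P° is the interior of P and ∂P is its boundary. -/
/-- The set of lattice points of `ℝ²`, i.e. points with integer coordinates. -/
def latticePts : Set (Fin 2 → ℝ) :=
  Set.range (fun v : Fin 2 → ℤ => fun i => (v i : ℝ))

open MeasureTheory Set

/-- The average of floor and ceiling. -/
noncomputable def floorCeilAvg (t : ℝ) : ℝ := ((⌊t⌋ : ℝ) + ⌈t⌉) / 2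

lemma floorCeilAvg_intCast_sub (m : ℤ) (t : ℝ) :
    floorCeilAvg (m - t) = m - floorCeilAvg t := by
  have h1 : ⌊(m : ℝ) - t⌋ = m - ⌈t⌉ := by
    rw [sub_eq_add_neg, Int.floor_intCast_add, Int.floor_neg]; ring
  have h2 : ⌈(m : ℝ) - t⌉ = m - ⌊t⌋ := by
    rw [sub_eq_add_neg, Int.ceil_intCast_add, Int.ceil_neg]; ring
  simp only [floorCeilAvg, h1, h2]
  push_cast
  ring

lemma floorCeilAvg_neg (t : ℝ) : floorCeilAvg (-t) = -floorCeilAvg t := by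
  simpa using floorCeilAvg_intCast_sub 0 t

/-- For an affine function with integer values at the integers `a < b`, the trapezoidal sum of its
rounded values equals the area of the trapezoid. -/
lemma sum_floorCeilAvg_affine {a b p q : ℤ} (hab : a < b) {u : ℝ → ℝ}
    (hu : ∀ n : ℤ, n ∈ Finset.Ioo a b → u n + u ((a + b - n : ℤ) : ℝ) = ((p + q : ℤ) : ℝ)) :
    ∑ n ∈ Finset.Ioo a b, floorCeilAvg (u n) = (b - a - 1) * (p + q) / 2 := by
  have hrefl : ∑ n ∈ Finset.Ioo a b, floorCeilAvg (u n) =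
      ∑ n ∈ Finset.Ioo a b, floorCeilAvg (u ((a + b - n : ℤ) : ℝ)) := by
    refine Finset.sum_nbij' (fun n => a + b - n) (fun n => a + b - n) ?_ ?_ ?_ ?_ ?_
    · intro n hn; simp only [Finset.mem_Ioo] at *; omega
    · intro n hn; simp only [Finset.mem_Ioo] at *; omega
    · intro n _; ring
    · intro n _; ring
    · intro n _; congr 3; ring
  have hsum : ∑ n ∈ Finset.Ioo a b, floorCeilAvg (u n) +
      ∑ n ∈ Finset.Ioo a b, floorCeilAvg (u n) = (b - a - 1) * (p + q) := by
    nth_rewrite 2 [hrefl]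
    rw [← Finset.sum_add_distrib, Finset.sum_congr rfl (g := fun _ => ((p + q : ℤ) : ℝ))]
    · rw [Finset.sum_const, Int.card_Ioo, nsmul_eq_mul]
      have : (((b - a - 1).toNat : ℤ) : ℝ) = ((b - a - 1 : ℤ) : ℝ) := by
        rw [Int.toNat_of_nonneg (by omega)]
      push_cast at this ⊢
      rw [this]
    · intro n hn
      rw [eq_sub_iff_add_eq'.mpr (hu n hn), floorCeilAvg_intCast_sub]
      ring
  linarith

lemma ConcaveOn.chord_le_mul {s : Set ℝ} {u : ℝ → ℝ} (h : ConcaveOn ℝ s u) {x y z : ℝ}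
    (hx : x ∈ s) (hz : z ∈ s) (hxy : x ≤ y) (hyz : y ≤ z) (hxz : x < z) :
    (z - y) * u x + (y - x) * u z ≤ (z - x) * u y := by
  have hpos : 0 < z - x := by linarith
  have h0 : 0 ≤ (z - y) / (z - x) := div_nonneg (by linarith) hpos.le
  have h1 : 0 ≤ (y - x) / (z - x) := div_nonneg (by linarith) hpos.le
  have := h.2 hx hz h0 h1 (by field_simp; ring)
  simp only [smul_eq_mul] at this
  have e : (z - y) / (z - x) * x + (y - x) / (z - x) * z = y := by field_simp; ring
  rw [e, div_mul_eq_mul_div, div_mul_eq_mul_div, ← add_div, div_le_iff₀ hpos] at this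
  linarith

/-- A concave function on `[A, B]` for which the maximum of its difference with each linear function
is attained at a lattice point of its graph. -/
structure IsLatticeConcave (A B : ℤ) (u : ℝ → ℝ) : Prop where
  concaveOn : ConcaveOn ℝ (Icc (A : ℝ) B) u
  exists_max : ∀ s : ℝ, ∃ c m : ℤ, (c : ℝ) ∈ Icc (A : ℝ) B ∧ u c = m ∧
    ∀ x ∈ Icc (A : ℝ) B, u x - s * x ≤ u c - s * c

namespace IsLatticeConcave

variable {A B : ℤ} {u : ℝ → ℝ}

lemma exists_left (h : IsLatticeConcave A B u) (hAB : A ≤ B) : ∃ m : ℤ, u A = m := by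
  have hAB' : (A : ℝ) ≤ B := by exact_mod_cast hAB
  obtain ⟨d, -, -, -, hd⟩ := h.exists_max 0
  obtain ⟨c, m, hc, hm, hmax⟩ := h.exists_max (u d - u A + 1)
  have h1 := hmax A ⟨le_rfl, hAB'⟩
  have h2 := hd c hc
  have h3 := hd A ⟨le_rfl, hAB'⟩
  have hle : A ≤ c := by exact_mod_cast hc.1
  obtain rfl | hlt := hle.eq_or_lt
  · exact ⟨m, hm⟩
  · have : (A : ℝ) + 1 ≤ c := by exact_mod_cast hlt
    nlinarith

lemma exists_right (h : IsLatticeConcave A B u) (hAB : A ≤ B) : ∃ m : ℤ, u B = m := by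
  have hAB' : (A : ℝ) ≤ B := by exact_mod_cast hAB
  obtain ⟨d, -, -, -, hd⟩ := h.exists_max 0
  obtain ⟨c, m, hc, hm, hmax⟩ := h.exists_max (-(u d - u B + 1))
  have h1 := hmax B ⟨hAB', le_rfl⟩
  have h2 := hd c hc
  have h3 := hd B ⟨hAB', le_rfl⟩
  have hle : c ≤ B := by exact_mod_cast hc.2
  obtain rfl | hlt := hle.eq_or_lt
  · exact ⟨m, hm⟩
  · have : (c : ℝ) + 1 ≤ B := by exact_mod_cast hlt
    nlinarith

/-- Between two lattice points of its graph, `u` is either affine or passes above the chord through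
a further lattice point. -/
lemma affine_or_exists (h : IsLatticeConcave A B u) {a b : ℤ} (hab : a < b) (ha : A ≤ a)
    (hb : b ≤ B) :
    (∀ x ∈ Icc (a : ℝ) b, u x = u a + (u b - u a) / (b - a) * (x - a)) ∨
      ∃ c m : ℤ, a < c ∧ c < b ∧ u c = m := by
  have hab' : (a : ℝ) < b := by exact_mod_cast hab
  have ha' : (A : ℝ) ≤ a := by exact_mod_cast ha
  have hb' : (b : ℝ) ≤ B := by exact_mod_cast hb
  have hamem : (a : ℝ) ∈ Icc (A : ℝ) B := ⟨ha', by linarith⟩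
  have hbmem : (b : ℝ) ∈ Icc (A : ℝ) B := ⟨by linarith, hb'⟩
  set s : ℝ := (u b - u a) / (b - a) with hs
  have hsb : s * (b - a) = u b - u a := div_mul_cancel₀ _ (by linarith)
  have hchord : ∀ x ∈ Icc (a : ℝ) b, u a + s * (x - a) ≤ u x := by
    intro x hx
    have := h.concaveOn.chord_le_mul hamem hbmem hx.1 hx.2 hab'
    have hpos : (0 : ℝ) < b - a := by linarith
    refine le_of_mul_le_mul_left ?_ hpos
    linear_combination this + (x - a) * hsb
  by_cases hall : ∀ x ∈ Icc (a : ℝ) b, u x ≤ u a + s * (x - a)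
  · exact Or.inl fun x hx => le_antisymm (hall x hx) (hchord x hx)
  · right
    push Not at hall
    obtain ⟨x, hx, hxlt⟩ := hall
    obtain ⟨c, m, hc, hm, hmax⟩ := h.exists_max s
    have hcx := hmax x ⟨by linarith [hx.1], by linarith [hx.2]⟩
    have hpos : u a + s * (c - a) < u c := by linarith
    refine ⟨c, m, ?_, ?_, hm⟩
    · by_contra! hca
      have hca' : (c : ℝ) ≤ a := by exact_mod_cast hca
      have := h.concaveOn.chord_le_mul hc hbmem hca' hab'.le (by linarith)
      nlinarith [mul_lt_mul_of_pos_left hpos (sub_pos.mpr hab')]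
    · by_contra! hca
      have hca' : (b : ℝ) ≤ c := by exact_mod_cast hca
      have := h.concaveOn.chord_le_mul hamem hc hab'.le hca' (by linarith)
      nlinarith [mul_lt_mul_of_pos_left hpos (sub_pos.mpr hab')]

/-- Between two lattice points of the graph, the integral of `u` is the trapezoidal sum of its
rounded values. -/
lemma integral_eq_sum (h : IsLatticeConcave A B u) {a b : ℤ} (hab : a < b) (ha : A ≤ a)
    (hb : b ≤ B) (hua : ∃ p : ℤ, u a = p) (hub : ∃ q : ℤ, u b = q) :
    IntervalIntegrable u volume a b ∧
      ∫ x in (a : ℝ)..b, u x = (u a + u b) / 2 + ∑ n ∈ Finset.Ioo a b, floorCeilAvg (u n) := by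
  induction hk : (b - a).toNat using Nat.strong_induction_on generalizing a b with
  | _ k ih =>
  have hab' : (a : ℝ) < b := by exact_mod_cast hab
  rcases h.affine_or_exists hab ha hb with haff | ⟨c, m, hac, hcb, hm⟩
  · obtain ⟨p, hp⟩ := hua
    obtain ⟨q, hq⟩ := hub
    have heq : EqOn (fun x => u a + (u b - u a) / (b - a) * (x - a)) u (uIcc (a : ℝ) b) := by
      rw [uIcc_of_le hab'.le]
      exact fun x hx => (haff x hx).symm
    have hint : IntervalIntegrable (fun x => u a + (u b - u a) / (b - a) * (x - a)) volume a b :=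
      Continuous.intervalIntegrable (by fun_prop) _ _
    refine ⟨hint.congr_uIoo (heq.mono uIoo_subset_uIcc_self), ?_⟩
    rw [← intervalIntegral.integral_congr heq, sum_floorCeilAvg_affine hab (p := p) (q := q)]
    · have hne : (b : ℝ) - a ≠ 0 := by linarith
      rw [intervalIntegral.integral_add (by simp) (Continuous.intervalIntegrable (by fun_prop) _ _),
        intervalIntegral.integral_const_mul,
        intervalIntegral.integral_sub (by simp) (by simp)]
      simp only [intervalIntegral.integral_const, integral_id, smul_eq_mul]
      rw [← hp, ← hq]
      field_simp
      ring
    · intro n hn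
      rw [Finset.mem_Ioo] at hn
      have h1 : (a : ℝ) ≤ n := by exact_mod_cast hn.1.le
      have h2 : (n : ℝ) ≤ b := by exact_mod_cast hn.2.le
      have hne : (b : ℝ) - a ≠ 0 := by linarith
      rw [haff n ⟨h1, h2⟩, haff ((a + b - n : ℤ) : ℝ) ⟨by push_cast; linarith, by push_cast; linarith⟩]
      push_cast
      rw [← hp, ← hq]
      field_simp
      ring
  · obtain ⟨i1, e1⟩ := ih _ (by omega) hac ha (by omega) hua ⟨m, hm⟩ rfl
    obtain ⟨i2, e2⟩ := ih _ (by omega) hcb (by omega) hb ⟨m, hm⟩ hub rfl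
    refine ⟨i1.trans i2, ?_⟩
    have hsplit : Finset.Ioo a b = insert c (Finset.Ioo a c ∪ Finset.Ioo c b) := by
      ext n; simp only [Finset.mem_Ioo, Finset.mem_insert, Finset.mem_union]; omega
    rw [← intervalIntegral.integral_add_adjacent_intervals i1 i2, e1, e2, hsplit,
      Finset.sum_insert (by simp), Finset.sum_union]
    · rw [show floorCeilAvg (u c) = u c by rw [hm]; simp [floorCeilAvg]]
      ring
    · rw [Finset.disjoint_left]
      intro n; simp only [Finset.mem_Ioo]; omega

end IsLatticeConcave

/-- The upper (`ε = 1`) and the negated lower (`ε = -1`) boundary function of a lattice polygon are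
lattice concave. -/
lemma isLatticeConcave_of_isGreatest {V : Finset (Fin 2 → ℤ)} {P : Set (Fin 2 → ℝ)}
    (hP : P = convexHull ℝ ((fun v : Fin 2 → ℤ => fun i => (v i : ℝ)) '' (V : Set (Fin 2 → ℤ))))
    (hV : V.Nonempty) {A B ε : ℤ} (hε : ε * ε = 1) (hVmem : ∀ v ∈ V, v 0 ∈ Icc A B) {u : ℝ → ℝ}
    (hu : ∀ x ∈ Icc (A : ℝ) B, IsGreatest {y | ![x, ε * y] ∈ P} (u x)) :
    IsLatticeConcave A B u := by
  have hεr : (ε : ℝ) * ε = 1 := by exact_mod_cast hε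
  have hconv : Convex ℝ P := hP ▸ convex_convexHull ℝ _
  refine ⟨⟨convex_Icc _ _, ?_⟩, ?_⟩
  · intro x hx y hy a b ha hb hab
    refine (hu _ (convex_Icc _ _ hx hy ha hb hab)).2 ?_
    change ![a • x + b • y, ε * (a • u x + b • u y)] ∈ P
    convert hconv (hu x hx).1 (hu y hy).1 ha hb hab using 1
    ext i
    fin_cases i
    · simp
    · simp; ring
  · intro s
    obtain ⟨v, hv, hvmax⟩ := V.exists_max_image (fun v => (ε * v 1 : ℝ) - s * v 0) hV
    have hvP : (fun i => (v i : ℝ)) ∈ P := hP ▸ subset_convexHull ℝ _ (mem_image_of_mem _ hv)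
    have hvA : ((v 0 : ℤ) : ℝ) ∈ Icc (A : ℝ) B :=
      ⟨by exact_mod_cast (hVmem v hv).1, by exact_mod_cast (hVmem v hv).2⟩
    have hle : P ⊆ {p | (ε * p 1 : ℝ) - s * p 0 ≤ ε * v 1 - s * v 0} := by
      rw [hP]
      refine convexHull_min ?_ (convex_halfSpace_le
        ⟨fun p q => by simp; ring, fun c p => by simp; ring⟩ _)
      rintro _ ⟨w, hw, rfl⟩
      exact hvmax w hw
    have hle' : ∀ x ∈ Icc (A : ℝ) B, u x - s * x ≤ ε * v 1 - s * v 0 := by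
      intro x hx
      have := hle (hu x hx).1
      simpa [← mul_assoc, hεr] using this
    have hge : (ε * v 1 : ℝ) ≤ u (v 0) := by
      refine (hu _ hvA).2 ?_
      change ![(v 0 : ℝ), ε * (ε * v 1)] ∈ P
      convert hvP using 1
      ext i
      fin_cases i
      · simp
      · simp [← mul_assoc, hεr]
    have heq : u (v 0) = ε * v 1 := le_antisymm (by linarith [hle' _ hvA]) hge
    refine ⟨v 0, ε * v 1, hvA, by rw [heq]; push_cast; rfl, fun x hx => ?_⟩
    rw [heq]
    exact hle' x hx

/-- The area of a planar region between two graphs over `[A, B]`. -/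
lemma volume_toReal_of_mem_iff {P : Set (Fin 2 → ℝ)} (hP : MeasurableSet P) {A B : ℝ} (hAB : A ≤ B)
    {l u : ℝ → ℝ} (hmem : ∀ x y, ![x, y] ∈ P ↔ x ∈ Icc A B ∧ y ∈ Icc (l x) (u x))
    (hlu : ∀ x ∈ Icc A B, l x ≤ u x)
    (hl : IntervalIntegrable l volume A B) (hu : IntervalIntegrable u volume A B) :
    (volume P).toReal = (∫ x in A..B, u x) - ∫ x in A..B, l x := by
  have hmp := (volume_preserving_finTwoArrow ℝ).symm
  have hslice : ∀ x, volume (Prod.mk x ⁻¹' (MeasurableEquiv.finTwoArrow.symm ⁻¹' P)) =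
      (Icc A B).indicator (fun x => ENNReal.ofReal (u x - l x)) x := by
    intro x
    have hset : Prod.mk x ⁻¹' (MeasurableEquiv.finTwoArrow.symm ⁻¹' P) =
        {y | x ∈ Icc A B ∧ y ∈ Icc (l x) (u x)} := by
      ext y
      exact hmem x y
    rw [hset]
    by_cases hx : x ∈ Icc A B
    · simp only [hx, true_and, indicator_of_mem, ofPred_mem_eq, Real.volume_Icc]
    · simp [hx]
  rw [← hmp.measure_preimage_equiv, Measure.volume_eq_prod,
    Measure.prod_apply (MeasurableEquiv.finTwoArrow.symm.measurable hP)]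
  simp_rw [hslice]
  rw [lintegral_indicator measurableSet_Icc, ← intervalIntegral.integral_sub hu hl,
    intervalIntegral.integral_of_le hAB, ← integral_Icc_eq_integral_Ioc,
    integral_eq_lintegral_of_nonneg_ae]
  · filter_upwards [ae_restrict_mem measurableSet_Icc] with x hx
    simpa using hlu x hx
  · have := (hu.sub hl).1.aestronglyMeasurable
    rwa [← restrict_Ioc_eq_restrict_Icc]

/-- A point of a compact convex planar region with nonempty interior is interior iff it lies
strictly between the boundary graphs. -/
lemma mem_interior_iff_of_mem_iff {P : Set (Fin 2 → ℝ)} (hconv : Convex ℝ P)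
    (hint : (interior P).Nonempty) {A B : ℝ} (hAB : A ≤ B)
    {l u : ℝ → ℝ} (hmem : ∀ x y, ![x, y] ∈ P ↔ x ∈ Icc A B ∧ y ∈ Icc (l x) (u x))
    (hlu : ∀ x ∈ Icc A B, l x ≤ u x) (x y : ℝ) :
    ![x, y] ∈ interior P ↔ x ∈ Ioo A B ∧ y ∈ Ioo (l x) (u x) := by
  constructor
  · intro h
    have h0 : Continuous fun t : ℝ => (![t, y] : Fin 2 → ℝ) :=
      continuous_pi fun i => by fin_cases i <;> simp <;> fun_prop
    have h1 : Continuous fun t : ℝ => (![x, t] : Fin 2 → ℝ) :=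
      continuous_pi fun i => by fin_cases i <;> simp <;> fun_prop
    have hx : x ∈ interior (Icc A B) :=
      interior_maximal (fun t ht => ((hmem t y).1 (interior_subset ht)).1)
        (isOpen_interior.preimage h0) h
    have hy : y ∈ interior (Icc (l x) (u x)) :=
      interior_maximal (fun t ht => ((hmem x t).1 (interior_subset ht)).2)
        (isOpen_interior.preimage h1) h
    rw [interior_Icc] at hx hy
    exact ⟨hx, hy⟩
  · rintro ⟨hx, hy⟩
    by_contra hnot
    obtain ⟨f, hf⟩ := geometric_hahn_banach_open_point hconv.interior isOpen_interior hnot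
    have hle : ∀ p ∈ P, f p ≤ f ![x, y] := by
      have : closure (interior P) ⊆ {p | f p ≤ f ![x, y]} :=
        closure_minimal (fun p hp => (hf p hp).le) (isClosed_le f.continuous continuous_const)
      rw [hconv.closure_interior_eq_closure_of_nonempty_interior hint] at this
      exact fun p hp => this (subset_closure hp)
    have hrep : ∀ p : Fin 2 → ℝ, f p = p 0 * f ![1, 0] + p 1 * f ![0, 1] := by
      intro p
      have : p = p 0 • ![1, 0] + p 1 • ![0, 1] := by
        ext i; fin_cases i <;> simp
      conv_lhs => rw [this]
      simp only [map_add, map_smul, smul_eq_mul]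
    have hxI : x ∈ Icc A B := Ioo_subset_Icc_self hx
    have hl := hle _ ((hmem x (l x)).2 ⟨hxI, le_rfl, hlu x hxI⟩)
    have hu := hle _ ((hmem x (u x)).2 ⟨hxI, hlu x hxI, le_rfl⟩)
    have hA := hle _ ((hmem A (l A)).2 ⟨left_mem_Icc.2 hAB, le_rfl, hlu A (left_mem_Icc.2 hAB)⟩)
    have hB := hle _ ((hmem B (l B)).2 ⟨right_mem_Icc.2 hAB, le_rfl, hlu B (right_mem_Icc.2 hAB)⟩)
    rw [hrep, hrep ![x, y]] at hl hu hA hB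
    simp only [Matrix.cons_val_zero, Matrix.cons_val_one] at hl hu hA hB
    have h1 : f ![0, 1] = 0 := by
      apply le_antisymm
      · nlinarith [hy.2]
      · nlinarith [hy.1]
    rw [h1] at hA hB
    have h2 : f ![1, 0] = 0 := by
      apply le_antisymm
      · nlinarith [hx.2]
      · nlinarith [hx.1]
    obtain ⟨p, hp⟩ := hint
    have := hf p hp
    rw [hrep, hrep ![x, y], h1, h2] at this
    simp at this

/-- The lattice points of a planar set whose integer columns are described by finite sets. -/
lemma ncard_inter_latticePts {S : Set (Fin 2 → ℝ)} {I : Finset ℤ} {J : ℤ → Finset ℤ}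
    (h : ∀ m n : ℤ, ![(m : ℝ), (n : ℝ)] ∈ S ↔ m ∈ I ∧ n ∈ J m) :
    (S ∩ latticePts).Finite ∧ (S ∩ latticePts).ncard = ∑ m ∈ I, (J m).card := by
  have hinj : Function.Injective
      (fun q : (_ : ℤ) × ℤ => (![(q.1 : ℝ), (q.2 : ℝ)] : Fin 2 → ℝ)) := by
    rintro ⟨a, b⟩ ⟨c, d⟩ hq
    have h0 := congrFun hq 0
    have h1 := congrFun hq 1
    simp only [Matrix.cons_val_zero, Matrix.cons_val_one, Int.cast_inj] at h0 h1
    rw [h0, h1]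
  have heq : S ∩ latticePts =
      (fun q : (_ : ℤ) × ℤ => (![(q.1 : ℝ), (q.2 : ℝ)] : Fin 2 → ℝ)) '' (I.sigma J : Finset _) := by
    ext p
    constructor
    · rintro ⟨hp, hlat⟩
      rw [latticePts, mem_range] at hlat
      obtain ⟨v, rfl⟩ := hlat
      have hv : (fun i => (v i : ℝ)) = ![(v 0 : ℝ), (v 1 : ℝ)] := by
        ext i; fin_cases i <;> rfl
      refine ⟨⟨v 0, v 1⟩, ?_, hv.symm⟩
      simp only [hv] at hp
      simpa using (h _ _).1 hp
    · rintro ⟨⟨m, n⟩, hq, rfl⟩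
      refine ⟨(h m n).2 (by simpa using hq), ?_⟩
      rw [latticePts, mem_range]
      refine ⟨![m, n], ?_⟩
      ext i; fin_cases i <;> rfl
  rw [heq]
  refine ⟨(Finset.finite_toSet _).image _, ?_⟩
  rw [ncard_image_of_injective _ hinj, ncard_coe_finset, Finset.card_sigma]

/-- The weighted count of the lattice points between two graphs, column by column. -/
lemma sum_card_add_sum_card {A B : ℤ} (hAB : A < B) {l u : ℝ → ℝ}
    (hlu : ∀ n ∈ Finset.Icc A B, l n ≤ u n) (hlt : ∀ n ∈ Finset.Ioo A B, l n < u n)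
    (hlA : ∃ m : ℤ, l A = m) (huA : ∃ m : ℤ, u A = m) (hlB : ∃ m : ℤ, l B = m)
    (huB : ∃ m : ℤ, u B = m) :
    ((∑ n ∈ Finset.Ioo A B, (Finset.Ioo ⌊l n⌋ ⌈u n⌉).card : ℕ) : ℝ) +
      ((∑ n ∈ Finset.Icc A B, (Finset.Icc ⌈l n⌉ ⌊u n⌋).card : ℕ) : ℝ) =
    2 * (∑ n ∈ Finset.Ioo A B, floorCeilAvg (u n) - ∑ n ∈ Finset.Ioo A B, floorCeilAvg (l n)) +
      (u A - l A) + (u B - l B) + 2 := by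
  have hcard : ∀ n ∈ Finset.Icc A B,
      ((Finset.Icc ⌈l n⌉ ⌊u n⌋).card : ℝ) = ⌊u n⌋ + 1 - ⌈l n⌉ := by
    intro n hn
    have h1 : ⌈l n⌉ < ⌊u n⌋ + 2 := by
      have h2 := Int.ceil_lt_add_one (l n)
      have h3 := Int.lt_floor_add_one (u n)
      have h4 := hlu n hn
      have : (⌈l n⌉ : ℝ) < ⌊u n⌋ + 2 := by linarith
      exact_mod_cast this
    rw [Int.card_Icc, ← Int.cast_natCast, Int.toNat_of_nonneg (by omega)]
    push_cast
    ring
  have hcard' : ∀ n ∈ Finset.Ioo A B,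
      ((Finset.Ioo ⌊l n⌋ ⌈u n⌉).card : ℝ) = ⌈u n⌉ - ⌊l n⌋ - 1 := by
    intro n hn
    have h1 : ⌊l n⌋ < ⌈u n⌉ := by
      have : (⌊l n⌋ : ℝ) < ⌈u n⌉ :=
        (Int.floor_le _).trans_lt ((hlt n hn).trans_le (Int.le_ceil _))
      exact_mod_cast this
    rw [Int.card_Ioo, ← Int.cast_natCast, Int.toNat_of_nonneg (by omega)]
    push_cast
    ring
  have hsplit : Finset.Icc A B = insert A (insert B (Finset.Ioo A B)) := by
    ext n; simp only [Finset.mem_Ioo, Finset.mem_insert, Finset.mem_Icc]; omega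
  push_cast
  rw [Finset.sum_congr rfl hcard, Finset.sum_congr rfl hcard', hsplit,
    Finset.sum_insert (by simp [hAB.ne]), Finset.sum_insert (by simp)]
  obtain ⟨a, ha⟩ := hlA
  obtain ⟨b, hb⟩ := huA
  obtain ⟨c, hc⟩ := hlB
  obtain ⟨d, hd⟩ := huB
  rw [ha, hb, hc, hd]
  simp only [Int.floor_intCast, Int.ceil_intCast]
  have : ∑ n ∈ Finset.Ioo A B, ((⌈u n⌉ : ℝ) - ⌊l n⌋ - 1) +
      ∑ n ∈ Finset.Ioo A B, ((⌊u n⌋ : ℝ) + 1 - ⌈l n⌉) =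
      2 * (∑ n ∈ Finset.Ioo A B, floorCeilAvg (u n) -
        ∑ n ∈ Finset.Ioo A B, floorCeilAvg (l n)) := by
    rw [← Finset.sum_add_distrib, ← Finset.sum_sub_distrib, Finset.mul_sum]
    refine Finset.sum_congr rfl fun n _ => ?_
    simp only [floorCeilAvg]
    ring
  linarith

lemma Convex.interior_nonempty_of_finrank_direction {E : Type*} [NormedAddCommGroup E]
    [NormedSpace ℝ E] [FiniteDimensional ℝ E] {P : Set E} (hconv : Convex ℝ P)
    (hne : P.Nonempty)
    (hdim : Module.finrank ℝ (affineSpan ℝ P).direction = Module.finrank ℝ E) :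
    (interior P).Nonempty := by
  rw [hconv.interior_nonempty_iff_affineSpan_eq_top,
    ← AffineSubspace.direction_eq_top_iff_of_nonempty ((affineSpan_nonempty ℝ).2 hne)]
  exact Submodule.eq_top_of_finrank_eq hdim

/-- A compact convex planar set is the region between two graphs over its projection to the
first axis. -/
lemma exists_boundary_functions {P : Set (Fin 2 → ℝ)} (hconv : Convex ℝ P) (hcomp : IsCompact P)
    {A B : ℝ} (hA : ∃ p ∈ P, p 0 = A) (hB : ∃ p ∈ P, p 0 = B) :
    ∃ l u : ℝ → ℝ, ∀ x ∈ Icc A B,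
      IsLeast {y | ![x, y] ∈ P} (l x) ∧ IsGreatest {y | ![x, y] ∈ P} (u x) := by
  have key : ∀ x ∈ Icc A B, IsCompact {y | ![x, y] ∈ P} ∧ {y | ![x, y] ∈ P}.Nonempty := by
    intro x hx
    constructor
    · have hcont : Continuous fun t : ℝ => (![x, t] : Fin 2 → ℝ) :=
        continuous_pi fun i => by fin_cases i <;> simp <;> fun_prop
      refine IsCompact.of_isClosed_subset (hcomp.image (continuous_apply 1))
        (hcomp.isClosed.preimage hcont) fun y hy => ⟨_, hy, rfl⟩
    · have himg : Convex ℝ ((fun p : Fin 2 → ℝ => p 0) '' P) :=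
        hconv.is_linear_image ⟨fun _ _ => rfl, fun _ _ => rfl⟩
      obtain ⟨p, hp, rfl⟩ := himg.ordConnected.out hA hB hx
      refine ⟨p 1, ?_⟩
      change ![p 0, p 1] ∈ P
      convert hp using 1
      ext i; fin_cases i <;> rfl
  choose! l hl using fun x hx => (key x hx).1.exists_isLeast (key x hx).2
  choose! u hu using fun x hx => (key x hx).1.exists_isGreatest (key x hx).2
  exact ⟨l, u, fun x hx => ⟨hl x hx, hu x hx⟩⟩

/-- Pick's theorem: for a lattice polygon `P ⊆ ℝ²` (a two-dimensional lattice polytope),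
the Euclidean area of `P` equals `|P° ∩ ℤ²| + |∂P ∩ ℤ²| / 2 - 1`. -/
theorem pick_theorem (V : Finset (Fin 2 → ℤ)) (P : Set (Fin 2 → ℝ))
    (hP : P = convexHull ℝ ((fun v : Fin 2 → ℤ => fun i => (v i : ℝ)) '' (V : Set (Fin 2 → ℤ))))
    (hdim : Module.finrank ℝ (affineSpan ℝ P).direction = 2) :
    (MeasureTheory.volume P).toReal =
      ((interior P ∩ latticePts).ncard : ℝ) + ((frontier P ∩ latticePts).ncard : ℝ) / 2 - 1 := by
  have hconv : Convex ℝ P := hP ▸ convex_convexHull ℝ _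
  have hcomp : IsCompact P := by
    rw [hP]
    exact (V.finite_toSet.image _).isCompact_convexHull ℝ
  have hV : V.Nonempty := by
    rw [Finset.nonempty_iff_ne_empty]
    rintro rfl
    rw [Finset.coe_empty, image_empty, convexHull_empty] at hP
    subst hP
    rw [AffineSubspace.span_empty, AffineSubspace.direction_bot, finrank_bot] at hdim
    exact absurd hdim (by norm_num)
  have hVP : ∀ v ∈ V, (fun i => (v i : ℝ)) ∈ P := fun v hv =>
    hP ▸ subset_convexHull ℝ _ (mem_image_of_mem _ hv)
  have hint : (interior P).Nonempty :=
    hconv.interior_nonempty_of_finrank_direction ⟨_, hVP _ hV.choose_spec⟩ (by simpa using hdim)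
  obtain ⟨vA, hvA, hminA⟩ := V.exists_min_image (fun v => v 0) hV
  obtain ⟨vB, hvB, hmaxB⟩ := V.exists_max_image (fun v => v 0) hV
  set A := vA 0
  set B := vB 0
  have hVmem : ∀ v ∈ V, v 0 ∈ Icc A B := fun v hv => ⟨hminA v hv, hmaxB v hv⟩
  have hABle : (A : ℝ) ≤ B := by exact_mod_cast hminA vB hvB
  have hcol : P ⊆ {p | p 0 ∈ Icc (A : ℝ) B} := by
    rw [hP]
    refine convexHull_min ?_
      ((convex_Icc (A : ℝ) B).is_linear_preimage (f := fun p : Fin 2 → ℝ => p 0)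
        ⟨fun _ _ => rfl, fun _ _ => rfl⟩)
    rintro _ ⟨v, hv, rfl⟩
    exact ⟨Int.cast_le.2 (hVmem v hv).1, Int.cast_le.2 (hVmem v hv).2⟩
  obtain ⟨l, u, hlu'⟩ := exists_boundary_functions hconv hcomp (A := A) (B := B)
    ⟨_, hVP vA hvA, rfl⟩ ⟨_, hVP vB hvB, rfl⟩
  have hlu : ∀ x ∈ Icc (A : ℝ) B, l x ≤ u x := fun x hx => (hlu' x hx).1.2 (hlu' x hx).2.1
  have hmem : ∀ x y, ![x, y] ∈ P ↔ x ∈ Icc (A : ℝ) B ∧ y ∈ Icc (l x) (u x) := by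
    intro x y
    constructor
    · intro h
      have hx : x ∈ Icc (A : ℝ) B := hcol h
      exact ⟨hx, (hlu' x hx).1.2 h, (hlu' x hx).2.2 h⟩
    · rintro ⟨hx, hy⟩
      have hslice : Convex ℝ {t | ![x, t] ∈ P} := by
        intro y hy z hz a b ha hb hab
        change ![x, a • y + b • z] ∈ P
        convert hconv (show ![x, y] ∈ P from hy) (show ![x, z] ∈ P from hz) ha hb hab using 1
        ext i
        fin_cases i
        · simp [← add_mul, hab]
        · simp
      exact hslice.ordConnected.out (hlu' x hx).1.1 (hlu' x hx).2.1 hy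
  have hmemint := mem_interior_iff_of_mem_iff hconv hint hABle hmem hlu
  have hu : IsLatticeConcave A B u :=
    isLatticeConcave_of_isGreatest hP hV (ε := 1) (by norm_num) hVmem
      (by simpa using fun x h1 h2 => (hlu' x ⟨h1, h2⟩).2)
  have hl : IsLatticeConcave A B (fun x => -l x) := by
    refine isLatticeConcave_of_isGreatest hP hV (ε := -1) (by norm_num) hVmem
      fun x hx => ⟨?_, fun y hy => ?_⟩
    · simpa using (hlu' x hx).1.1
    · have : ![x, -y] ∈ P := by simpa using hy
      linarith [(hlu' x hx).1.2 this]
  obtain ⟨p, hp⟩ := hint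
  have hp' : ![p 0, p 1] ∈ interior P := by
    convert hp using 1
    ext i; fin_cases i <;> rfl
  obtain ⟨hpx, hpy⟩ := (hmemint _ _).1 hp'
  have hAB' : (A : ℝ) < B := hpx.1.trans hpx.2
  have hAB : A < B := by exact_mod_cast hAB'
  have hlt : ∀ x ∈ Ioo (A : ℝ) B, l x < u x := by
    intro x hx
    have hconc : ConcaveOn ℝ (Icc (A : ℝ) B) (fun x => u x + -l x) :=
      hu.concaveOn.add hl.concaveOn
    have hAm := left_mem_Icc.2 hABle
    have hBm := right_mem_Icc.2 hABle
    have hppos : 0 < u (p 0) + -l (p 0) := by linarith [hpy.1, hpy.2]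
    suffices 0 < u x + -l x by linarith
    rcases le_total x (p 0) with hxp | hxp
    · have := hconc.chord_le_mul hAm (Ioo_subset_Icc_self hpx) hx.1.le hxp hpx.1
      have h1 := mul_nonneg (sub_nonneg.2 hxp) (sub_nonneg.2 (hlu _ hAm))
      have h2 := mul_pos (sub_pos.2 hx.1) hppos
      exact pos_of_mul_pos_right (a := p 0 - A) (by linarith) (sub_nonneg.2 hpx.1.le)
    · have := hconc.chord_le_mul (Ioo_subset_Icc_self hpx) hBm hxp hx.2.le hpx.2
      have h1 := mul_nonneg (sub_nonneg.2 hxp) (sub_nonneg.2 (hlu _ hBm))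
      have h2 := mul_pos (sub_pos.2 hx.2) hppos
      exact pos_of_mul_pos_right (a := B - p 0) (by linarith) (sub_nonneg.2 hpx.2.le)
  obtain ⟨iu, eu⟩ := hu.integral_eq_sum hAB le_rfl le_rfl (hu.exists_left hAB.le)
    (hu.exists_right hAB.le)
  obtain ⟨il, el⟩ := hl.integral_eq_sum hAB le_rfl le_rfl (hl.exists_left hAB.le)
    (hl.exists_right hAB.le)
  have hneg : ∀ t : ℝ, (∃ m : ℤ, -t = m) → ∃ m : ℤ, t = m := fun t ⟨m, hm⟩ =>
    ⟨-m, by push_cast; linarith⟩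
  have il' : IntervalIntegrable l volume A B := by
    simpa [Pi.neg_def] using il.neg
  simp only [floorCeilAvg_neg, Finset.sum_neg_distrib, intervalIntegral.integral_neg] at el
  obtain ⟨-, hI⟩ := ncard_inter_latticePts (S := interior P) (I := Finset.Ioo A B)
    (J := fun n => Finset.Ioo ⌊l n⌋ ⌈u n⌉) fun m n => by
      simp [hmemint, Int.floor_lt, Int.lt_ceil]
  obtain ⟨hTfin, hT⟩ := ncard_inter_latticePts (S := P) (I := Finset.Icc A B)
    (J := fun n => Finset.Icc ⌈l n⌉ ⌊u n⌋) fun m n => by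
      simp [hmem, Int.ceil_le, Int.le_floor]
  have hF : (frontier P ∩ latticePts).ncard + (interior P ∩ latticePts).ncard =
      (P ∩ latticePts).ncard := by
    rw [← ncard_sdiff_add_ncard_of_subset (inter_subset_inter_left _ interior_subset) hTfin,
      hcomp.isClosed.frontier_eq]
    congr 2
    ext q
    simp only [mem_inter_iff, mem_sdiff]
    tauto
  have hF' : ((frontier P ∩ latticePts).ncard : ℝ) + (interior P ∩ latticePts).ncard =
      (P ∩ latticePts).ncard := by exact_mod_cast hF
  have hsum := sum_card_add_sum_card hAB
    (fun n hn => hlu n (by rw [Finset.mem_Icc] at hn; exact ⟨mod_cast hn.1, mod_cast hn.2⟩))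
    (fun n hn => hlt n (by rw [Finset.mem_Ioo] at hn; exact ⟨mod_cast hn.1, mod_cast hn.2⟩))
    (hneg _ (hl.exists_left hAB.le)) (hu.exists_left hAB.le)
    (hneg _ (hl.exists_right hAB.le)) (hu.exists_right hAB.le)
  rw [← hI, ← hT] at hsum
  rw [volume_toReal_of_mem_iff hcomp.isClosed.measurableSet hABle hmem hlu il' iu]
  linarith
end

section
/- For every integer r > 1, every lattice point of the cone C_{R_r} over the Reeve tetrahedron R_r can be written as a sum, with nonnegative integer coefficients, of the points (0,0,0,1), (1,0,0,1), (0,1,0,1), (1,1,r,1), (1,1,1,2), …, (1,1,r−1,2) ∈ ℤ⁴. -/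
/-- The real point of `ℝ³` corresponding to an integer vector. -/
def Z3R (v : Fin 3 → ℤ) : Fin 3 → ℝ := fun i => (v i : ℝ)

/-- The Reeve tetrahedron `R_r = conv((0,0,0), (1,0,0), (0,1,0), (1,1,r)) ⊆ ℝ³`. -/
def reeve (r : ℤ) : Set (Fin 3 → ℝ) :=
  convexHull ℝ ({Z3R ![0, 0, 0], Z3R ![1, 0, 0], Z3R ![0, 1, 0], Z3R ![1, 1, r]} :
    Set (Fin 3 → ℝ))

/-- The cone over a polytope `P ⊆ ℝ³`, namely `C_P = {λ(x,1) : λ ≥ 0, x ∈ P} ⊆ ℝ⁴`,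
modelled as a subset of `(Fin 3 → ℝ) × ℝ`; the height of a point is its last coordinate. -/
def coneOver (P : Set (Fin 3 → ℝ)) : Set ((Fin 3 → ℝ) × ℝ) :=
  {p | ∃ lam : ℝ, 0 ≤ lam ∧ ∃ x ∈ P, p = (lam • x, lam)}

theorem reeve_subset_halfspaces {r : ℤ} (hr : 0 ≤ r) {x : Fin 3 → ℝ} (hx : x ∈ reeve r) :
    0 ≤ x 2 ∧ x 2 ≤ r * x 0 ∧ x 2 ≤ r * x 1 ∧ r * (x 0 + x 1) - x 2 ≤ r := by
  have hr' : (0 : ℝ) ≤ r := by exact_mod_cast hr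
  have key : reeve r ⊆ {x : Fin 3 → ℝ |
      0 ≤ x 2 ∧ x 2 ≤ r * x 0 ∧ x 2 ≤ r * x 1 ∧ r * (x 0 + x 1) - x 2 ≤ r} := by
    refine convexHull_min ?_ ?_
    · rintro p (rfl | rfl | rfl | rfl) <;> simp [Z3R, hr']
      linarith
    · rintro p ⟨p1, p2, p3, p4⟩ q ⟨q1, q2, q3, q4⟩ a b ha hb hab
      obtain rfl : b = 1 - a := by linarith
      simp only [Set.mem_ofPred_eq, Pi.add_apply, Pi.smul_apply, smul_eq_mul]
      refine ⟨by positivity, ?_, ?_, ?_⟩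
      · nlinarith [mul_le_mul_of_nonneg_left p2 ha, mul_le_mul_of_nonneg_left q2 hb]
      · nlinarith [mul_le_mul_of_nonneg_left p3 ha, mul_le_mul_of_nonneg_left q3 hb]
      · nlinarith [mul_le_mul_of_nonneg_left p4 ha, mul_le_mul_of_nonneg_left q4 hb]
  exact key hx

theorem lattice_point_inequalities_of_mem_coneOver_reeve {r : ℤ} (hr : 0 ≤ r) {v : Fin 3 → ℤ}
    {k : ℤ} (h : (Z3R v, (k : ℝ)) ∈ coneOver (reeve r)) :
    0 ≤ v 2 ∧ v 2 ≤ r * v 0 ∧ v 2 ≤ r * v 1 ∧ r * (v 0 + v 1) - v 2 ≤ r * k := by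
  obtain ⟨lam, hlam, x, hx, hp⟩ := h
  obtain ⟨hv, hk⟩ := Prod.mk.inj hp
  have hc (i : Fin 3) : (v i : ℝ) = lam * x i := congrFun hv i
  obtain ⟨h1, h2, h3, h4⟩ := reeve_subset_halfspaces hr hx
  rify
  rw [hc 0, hc 1, hc 2, hk]
  refine ⟨by positivity, ?_, ?_, ?_⟩
  · nlinarith [mul_le_mul_of_nonneg_left h2 hlam]
  · nlinarith [mul_le_mul_of_nonneg_left h3 hlam]
  · nlinarith [mul_le_mul_of_nonneg_left h4 hlam]

/-- For `r > 1`, every lattice point `(v, k)` of the cone over the Reeve tetrahedron `R_r`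
is a sum with nonnegative integer coefficients of the points `(0,0,0,1)`, `(1,0,0,1)`,
`(0,1,0,1)`, `(1,1,r,1)`, and `(1,1,s,2)` for `s = 1, …, r-1`. -/
theorem reeve_cone_semigroup_generators (r : ℤ) (hr : 1 < r)
    (v : Fin 3 → ℤ) (k : ℤ) (hvk : (Z3R v, (k : ℝ)) ∈ coneOver (reeve r)) :
    ∃ (a b c e : ℕ) (t : Fin (r - 1).toNat → ℕ),
      v = a • (![0, 0, 0] : Fin 3 → ℤ) + b • ![1, 0, 0] + c • ![0, 1, 0] + e • ![1, 1, r] +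
          ∑ j, t j • (![1, 1, (j : ℕ) + 1] : Fin 3 → ℤ) ∧
      k = a + b + c + e + 2 * ∑ j, (t j : ℤ) := by
  obtain ⟨h1, h2, h3, h4⟩ := lattice_point_inequalities_of_mem_coneOver_reeve (by lia) hvk
  have hdiv := Int.emod_add_mul_ediv (v 2) r
  have hs0 := Int.emod_nonneg (v 2) (by lia : r ≠ 0)
  have hsr := Int.emod_lt_of_pos (v 2) (by lia : 0 < r)
  have he : 0 ≤ v 2 / r := Int.ediv_nonneg h1 (by lia)
  generalize v 2 / r = e at *
  generalize v 2 % r = s at *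
  lift e to ℕ using he
  have ha : 0 ≤ k - v 0 - v 1 + e := by
    by_contra! hneg
    nlinarith
  obtain ⟨a, ha⟩ := Int.eq_ofNat_of_zero_le ha
  rcases hs0.eq_or_lt with rfl | hs
  · have hb : 0 ≤ v 0 - e := by
      by_contra! hneg
      nlinarith
    have hc : 0 ≤ v 1 - e := by
      by_contra! hneg
      nlinarith
    obtain ⟨b, hb⟩ := Int.eq_ofNat_of_zero_le hb
    obtain ⟨c, hc⟩ := Int.eq_ofNat_of_zero_le hc
    refine ⟨a, b, c, e, 0, ?_, ?_⟩
    · ext i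
      fin_cases i <;> simp <;> linarith
    · simp
      linarith
  · have hb : 0 ≤ v 0 - e - 1 := by
      by_contra! hneg
      nlinarith
    have hc : 0 ≤ v 1 - e - 1 := by
      by_contra! hneg
      nlinarith
    obtain ⟨b, hb⟩ := Int.eq_ofNat_of_zero_le hb
    obtain ⟨c, hc⟩ := Int.eq_ofNat_of_zero_le hc
    let j : Fin (r - 1).toNat := ⟨(s - 1).toNat, by lia⟩
    have hj : ((j : ℕ) : ℤ) = s - 1 := Int.toNat_of_nonneg (by lia)
    have hsum : ∑ i, (Pi.single j 1 : Fin (r - 1).toNat → ℕ) i •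
        (![1, 1, (i : ℕ) + 1] : Fin 3 → ℤ) = ![1, 1, s] := by
      rw [Finset.sum_eq_single j (fun i _ hi => by simp [hi]) (by simp)]
      simp [hj]
    have hcount : ∑ i, ((Pi.single j 1 : Fin (r - 1).toNat → ℕ) i : ℤ) = 1 := by
      rw [Finset.sum_eq_single j (fun i _ hi => by simp [hi]) (by simp)]
      simp
    refine ⟨a, b, c, e, Pi.single j 1, ?_, ?_⟩
    · rw [hsum]
      ext i
      fin_cases i <;> simp <;> linarith
    · rw [hcount]
      linarith
end
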